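/- Let n ≥ 1 and let ψ : ℕ × ℕ → ℝ be any function. Then the sum over all partitions p of {1, …, n} of the product over the cells C of p of ψ(|C|, max C) equals the sum over all S-paths S of n+1 coordinates of [∏_{j : m_j > 0} binom(j − 1 − S_{j−1}, j − S_j)] · [∏_{j : m_j > 0} ψ(m_j, j)], where m_j = S_j − S_{j−1} and both inner products range over j ∈ {1, …, n} with m_j > 0. -/

import Mathlib

/-- An S-path of `n+1` coordinates. -/
def IsSPath (n : ℕ) (S : ℕ → ℕ) : Prop :=
  S 0 = 0 ∧ S n = n ∧ (∀ j < n, S j ≤ j) ∧ ∀ j < n, S j ≤ S (j + 1)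

/-- The family `Q` consists of disjoint cells inside `{1,…,k}`, whose maxima are the positions in
`{1,…,k}` where `S` increases, the cell with maximum `j` having `S j - S (j - 1)` elements. -/
structure IsPathFamily (S : ℕ → ℕ) (k : ℕ) (Q : Finset (Finset ℕ)) : Prop where
  subset : ∀ C ∈ Q, C ⊆ Finset.Icc 1 k
  nonempty : ∀ C ∈ Q, C.Nonempty
  disjoint : ∀ C ∈ Q, ∀ D ∈ Q, ∀ x ∈ C, x ∈ D → C = D
  exists_sup : ∀ j ∈ Finset.Icc 1 k, S (j - 1) < S j → ∃ C ∈ Q, C.sup id = j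
  card_add : ∀ C ∈ Q, C.card + S (C.sup id - 1) = S (C.sup id)

theorem Finset.Nonempty.sup_id_mem {C : Finset ℕ} (h : C.Nonempty) : C.sup id ∈ C := by
  obtain ⟨x, hx, hxs⟩ := C.exists_mem_eq_sup h id
  rw [hxs]; exact hx

theorem Finset.le_sup_id_of_mem {C : Finset ℕ} {x : ℕ} (h : x ∈ C) : x ≤ C.sup id :=
  Finset.le_sup (f := id) h

theorem Finset.sup_id_eq_of_subset_Icc {C : Finset ℕ} {k : ℕ} (h : C ⊆ Finset.Icc 1 k)
    (hk : k ∈ C) : C.sup id = k :=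
  le_antisymm (Finset.sup_le fun _ hx => (Finset.mem_Icc.1 (h hx)).2) (le_sup_id_of_mem hk)

namespace IsPathFamily

variable {S : ℕ → ℕ} {k : ℕ} {Q : Finset (Finset ℕ)}

theorem sup_mem_filter (h : IsPathFamily S k Q) {C : Finset ℕ} (hC : C ∈ Q) :
    C.sup id ∈ (Finset.Icc 1 k).filter (fun j => S (j - 1) < S j) := by
  have hne := h.nonempty C hC
  have := h.card_add C hC
  have := hne.card_pos
  exact Finset.mem_filter.2 ⟨h.subset C hC hne.sup_id_mem, by omega⟩

theorem injOn_sup (h : IsPathFamily S k Q) : Set.InjOn (fun C : Finset ℕ => C.sup id) Q := by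
  intro C hC D hD hCD
  refine h.disjoint C hC D hD _ (h.nonempty C hC).sup_id_mem ?_
  have hCD' : C.sup id = D.sup id := hCD
  rw [hCD']
  exact (h.nonempty D hD).sup_id_mem

theorem prod_eq {M : Type*} [CommMonoid M] (h : IsPathFamily S k Q) (f : ℕ → ℕ → M) :
    ∏ C ∈ Q, f C.card (C.sup id) =
      ∏ j ∈ (Finset.Icc 1 k).filter (fun j => S (j - 1) < S j), f (S j - S (j - 1)) j := by
  refine Finset.prod_nbij (fun C => C.sup id) (fun C hC => h.sup_mem_filter hC) h.injOn_sup ?_ ?_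
  · intro j hj
    obtain ⟨hj, hlt⟩ := Finset.mem_filter.1 hj
    exact h.exists_sup j hj hlt
  · intro C hC
    have := h.card_add C hC
    congr 1
    omega

theorem sum_eq {M : Type*} [AddCommMonoid M] (h : IsPathFamily S k Q) (f : ℕ → ℕ → M) :
    ∑ C ∈ Q, f C.card (C.sup id) =
      ∑ j ∈ (Finset.Icc 1 k).filter (fun j => S (j - 1) < S j), f (S j - S (j - 1)) j :=
  h.prod_eq (M := Multiplicative M) f

theorem sum_card_filter (h : IsPathFamily S k Q) (h0 : S 0 = 0)
    (hS : ∀ j < k, S j ≤ S (j + 1)) {i : ℕ} (hi : i ≤ k) :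
    ∑ C ∈ Q with C.sup id ≤ i, C.card = S i := by
  rw [Finset.sum_filter, h.sum_eq (fun m j => if j ≤ i then m else 0), ← Finset.sum_filter,
    Finset.filter_filter]
  have key : ∀ i ≤ k, ∑ j ∈ Finset.range i, (S (j + 1) - S j) = S i := by
    intro i
    induction i with
    | zero => simp [h0]
    | succ i ih =>
      intro hi
      have := hS i hi
      rw [Finset.sum_range_succ, ih (by omega)]
      omega
  rw [← key i hi]
  refine Finset.sum_bij_ne_zero (fun j _ _ => j - 1) ?_ ?_ ?_ ?_
  · intro j hj _
    simp only [Finset.mem_filter, Finset.mem_Icc] at hj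
    simp only [Finset.mem_range]
    omega
  · intro a ha _ b hb _ hab
    simp only [Finset.mem_filter, Finset.mem_Icc] at ha hb
    omega
  · intro b hb hb'
    simp only [Finset.mem_range] at hb
    refine ⟨b + 1, ?_, by simpa using hb', by simp⟩
    simp only [Finset.mem_filter, Finset.mem_Icc, Nat.add_sub_cancel]
    omega
  · intro j hj _
    simp only [Finset.mem_filter, Finset.mem_Icc] at hj
    rw [Nat.sub_add_cancel hj.1.1]

theorem pairwiseDisjoint (h : IsPathFamily S k Q) : (Q : Set (Finset ℕ)).PairwiseDisjoint id :=
  fun C hC D hD hCD => Finset.disjoint_left.2 fun x hx hx' => hCD (h.disjoint C hC D hD x hx hx')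

theorem card_biUnion (h : IsPathFamily S k Q) (h0 : S 0 = 0)
    (hS : ∀ j < k, S j ≤ S (j + 1)) : (Q.biUnion id).card = S k := by
  rw [Finset.card_biUnion h.pairwiseDisjoint, ← h.sum_card_filter h0 hS le_rfl,
    Finset.filter_true_of_mem]
  · rfl
  · intro C hC
    exact (Finset.mem_Icc.1 (Finset.mem_filter.1 (h.sup_mem_filter hC)).1).2

theorem biUnion_subset (h : IsPathFamily S k Q) : Q.biUnion id ⊆ Finset.Icc 1 k :=
  Finset.biUnion_subset.2 h.subset

theorem succ_iff_of_eq (hk : S (k + 1) = S k) :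
    IsPathFamily S (k + 1) Q ↔ IsPathFamily S k Q := by
  constructor
  · intro h
    refine ⟨fun C hC x hx => ?_, h.nonempty, h.disjoint, fun j hj hlt => ?_, h.card_add⟩
    · have h1 := Finset.mem_filter.1 (h.sup_mem_filter hC)
      have h2 := Finset.mem_Icc.1 h1.1
      have h3 := Finset.mem_Icc.1 (h.subset C hC hx)
      have h4 := Finset.le_sup_id_of_mem hx
      have h5 : C.sup id ≠ k + 1 := by
        intro he
        rw [he] at h1
        have := h1.2
        simp only [Nat.add_sub_cancel] at this
        omega
      exact Finset.mem_Icc.2 (by omega)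
    · exact h.exists_sup j (Finset.Icc_subset_Icc_right (Nat.le_succ k) hj) hlt
  · intro h
    refine ⟨fun C hC => (h.subset C hC).trans (Finset.Icc_subset_Icc_right (Nat.le_succ k)),
      h.nonempty, h.disjoint, fun j hj hlt => ?_, h.card_add⟩
    refine h.exists_sup j ?_ hlt
    have h2 := Finset.mem_Icc.1 hj
    have h5 : j ≠ k + 1 := by
      rintro rfl
      simp only [Nat.add_sub_cancel] at hlt
      omega
    exact Finset.mem_Icc.2 (by omega)

theorem insert_cell (h : IsPathFamily S k Q) {D : Finset ℕ}
    (hD : D ⊆ Finset.Icc 1 k \ Q.biUnion id) (hcard : D.card + 1 + S k = S (k + 1)) :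
    IsPathFamily S (k + 1) (insert (insert (k + 1) D) Q) := by
  have hDk : ∀ x ∈ D, 1 ≤ x ∧ x ≤ k := fun x hx =>
    Finset.mem_Icc.1 (Finset.mem_sdiff.1 (hD hx)).1
  have hDQ : ∀ x ∈ insert (k + 1) D, ∀ C ∈ Q, x ∉ C := by
    intro x hx C hC hxC
    rcases Finset.mem_insert.1 hx with rfl | hx
    · have := Finset.mem_Icc.1 (h.subset C hC hxC)
      omega
    · exact (Finset.mem_sdiff.1 (hD hx)).2 (Finset.mem_biUnion.2 ⟨C, hC, hxC⟩)
  have hsub : insert (k + 1) D ⊆ Finset.Icc 1 (k + 1) := by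
    intro x hx
    rcases Finset.mem_insert.1 hx with rfl | hx
    · simp
    · have := hDk x hx
      exact Finset.mem_Icc.2 (by omega)
  have hsup : (insert (k + 1) D).sup id = k + 1 :=
    Finset.sup_id_eq_of_subset_Icc hsub (Finset.mem_insert_self _ _)
  refine ⟨?_, ?_, ?_, ?_, ?_⟩
  · intro C hC
    rcases Finset.mem_insert.1 hC with rfl | hC
    · exact hsub
    · exact (h.subset C hC).trans (Finset.Icc_subset_Icc_right (Nat.le_succ k))
  · intro C hC
    rcases Finset.mem_insert.1 hC with rfl | hC
    · exact Finset.insert_nonempty _ _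
    · exact h.nonempty C hC
  · intro C hC E hE x hx hx'
    rcases Finset.mem_insert.1 hC with rfl | hC <;> rcases Finset.mem_insert.1 hE with rfl | hE
    · rfl
    · exact absurd hx' (hDQ x hx E hE)
    · exact absurd hx (hDQ x hx' C hC)
    · exact h.disjoint C hC E hE x hx hx'
  · intro j hj hlt
    by_cases hjk : j = k + 1
    · exact ⟨_, Finset.mem_insert_self _ _, hsup.trans hjk.symm⟩
    · have := Finset.mem_Icc.1 hj
      obtain ⟨C, hC, hCj⟩ := h.exists_sup j (Finset.mem_Icc.2 (by omega)) hlt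
      exact ⟨C, Finset.mem_insert_of_mem hC, hCj⟩
  · intro C hC
    rcases Finset.mem_insert.1 hC with rfl | hC
    · rw [hsup, Finset.card_insert_of_notMem fun hk => by have := hDk _ hk; omega]
      exact hcard
    · exact h.card_add C hC

theorem filter_notMem (h : IsPathFamily S (k + 1) Q) :
    IsPathFamily S k (Q.filter (fun C => k + 1 ∉ C)) := by
  refine ⟨fun C hC x hx => ?_, fun C hC => h.nonempty C (Finset.mem_filter.1 hC).1,
    fun C hC D hD => h.disjoint C (Finset.mem_filter.1 hC).1 D (Finset.mem_filter.1 hD).1,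
    fun j hj hlt => ?_, fun C hC => h.card_add C (Finset.mem_filter.1 hC).1⟩
  · have hC := Finset.mem_filter.1 hC
    have := Finset.mem_Icc.1 (h.subset C hC.1 hx)
    have : x ≠ k + 1 := fun he => hC.2 (he ▸ hx)
    exact Finset.mem_Icc.2 (by omega)
  · have hj' := Finset.mem_Icc.1 hj
    obtain ⟨C, hC, hCj⟩ := h.exists_sup j (Finset.mem_Icc.2 (by omega)) hlt
    refine ⟨C, Finset.mem_filter.2 ⟨hC, fun hk => ?_⟩, hCj⟩
    have := Finset.le_sup_id_of_mem hk
    omega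

theorem exists_eq_insert (h : IsPathFamily S (k + 1) Q) (hk : S k < S (k + 1)) :
    ∃ D ⊆ Finset.Icc 1 k \ (Q.filter (fun C => k + 1 ∉ C)).biUnion id,
      D.card + 1 + S k = S (k + 1) ∧
        insert (insert (k + 1) D) (Q.filter (fun C => k + 1 ∉ C)) = Q := by
  obtain ⟨C, hC, hsup⟩ := h.exists_sup (k + 1) (by simp) hk
  have hkC : k + 1 ∈ C := by
    have := (h.nonempty C hC).sup_id_mem
    rwa [hsup] at this
  have hcard := h.card_add C hC
  rw [hsup, Nat.add_sub_cancel] at hcard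
  refine ⟨C.erase (k + 1), fun x hx => ?_, ?_, ?_⟩
  · obtain ⟨hxk, hx⟩ := Finset.mem_erase.1 hx
    have := Finset.mem_Icc.1 (h.subset C hC hx)
    refine Finset.mem_sdiff.2 ⟨Finset.mem_Icc.2 (by omega), fun hx' => ?_⟩
    obtain ⟨E, hE, hxE⟩ := Finset.mem_biUnion.1 hx'
    obtain ⟨hE, hkE⟩ := Finset.mem_filter.1 hE
    exact hkE (h.disjoint C hC E hE x hx hxE ▸ hkC)
  · rw [Finset.card_erase_add_one hkC, hcard]
  · rw [Finset.insert_erase hkC]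
    ext E
    rw [Finset.mem_insert, Finset.mem_filter]
    constructor
    · rintro (rfl | hE)
      · exact hC
      · exact hE.1
    · intro hE
      by_cases hkE : k + 1 ∈ E
      · exact Or.inl (h.disjoint E hE C hC _ hkE hkC)
      · exact Or.inr ⟨hE, hkE⟩

end IsPathFamily

open Classical in
/-- The finite set of all families satisfying `IsPathFamily S k`. -/
noncomputable def pathFamilies (S : ℕ → ℕ) (k : ℕ) : Finset (Finset (Finset ℕ)) :=
  (Finset.Icc 1 k).powerset.powerset.filter (IsPathFamily S k)

theorem mem_pathFamilies {S : ℕ → ℕ} {k : ℕ} {Q : Finset (Finset ℕ)} :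
    Q ∈ pathFamilies S k ↔ IsPathFamily S k Q := by
  classical
  rw [pathFamilies, Finset.mem_filter, and_iff_right_iff_imp]
  exact fun h => Finset.mem_powerset.2 fun C hC => Finset.mem_powerset.2 (h.subset C hC)

theorem pathFamilies_zero (S : ℕ → ℕ) : pathFamilies S 0 = {∅} := by
  ext Q
  rw [mem_pathFamilies, Finset.mem_singleton]
  constructor
  · intro h
    refine Finset.eq_empty_of_forall_notMem fun C hC => ?_
    obtain ⟨x, hx⟩ := h.nonempty C hC
    simpa using h.subset C hC hx
  · rintro rfl
    constructor <;> simp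

theorem card_pathFamilies_succ {S : ℕ → ℕ} {k : ℕ} (h0 : S 0 = 0)
    (hS : ∀ j < k, S j ≤ S (j + 1)) (hk : S k < S (k + 1)) (hle : S (k + 1) ≤ k + 1) :
    (pathFamilies S (k + 1)).card =
      (pathFamilies S k).card * (k - S k).choose (k + 1 - S (k + 1)) := by
  have hcount : ∀ Q ∈ pathFamilies S k,
      ((Finset.Icc 1 k \ Q.biUnion id).powersetCard (S (k + 1) - S k - 1)).card =
        (k - S k).choose (k + 1 - S (k + 1)) := by
    intro Q hQ
    have hQ := mem_pathFamilies.1 hQ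
    rw [Finset.card_powersetCard, Finset.card_sdiff_of_subset hQ.biUnion_subset,
      hQ.card_biUnion h0 hS, Nat.card_Icc, Nat.add_sub_cancel]
    exact Nat.choose_symm_of_eq_add (by omega)
  rw [← smul_eq_mul, ← Finset.sum_const, ← Finset.sum_congr rfl hcount, ← Finset.card_sigma]
  symm
  have hfilter : ∀ Q D, IsPathFamily S k Q →
      (insert (insert (k + 1) D) Q).filter (fun C => k + 1 ∉ C) = Q := by
    intro Q D hQ
    rw [Finset.filter_insert, if_neg (by simp), Finset.filter_true_of_mem]
    intro C hC hkC
    have := Finset.mem_Icc.1 (hQ.subset C hC hkC)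
    omega
  refine Finset.card_bij (fun x _ => insert (insert (k + 1) x.2) x.1) ?_ ?_ ?_
  · rintro ⟨Q, D⟩ hx
    obtain ⟨hQ, hD⟩ := Finset.mem_sigma.1 hx
    obtain ⟨hD, hcard⟩ := Finset.mem_powersetCard.1 hD
    exact mem_pathFamilies.2 ((mem_pathFamilies.1 hQ).insert_cell hD (by dsimp only at *; omega))
  · rintro ⟨Q, D⟩ hx ⟨Q', D'⟩ hx' heq
    obtain ⟨hQ, hD⟩ := Finset.mem_sigma.1 hx
    obtain ⟨hQ', hD'⟩ := Finset.mem_sigma.1 hx'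
    have hD := (Finset.mem_powersetCard.1 hD).1
    have hD' := (Finset.mem_powersetCard.1 hD').1
    have hQ := mem_pathFamilies.1 hQ
    have hQ' := mem_pathFamilies.1 hQ'
    dsimp only at hQ hQ' hD hD' heq
    have hQQ : Q = Q' := by rw [← hfilter Q D hQ, heq, hfilter Q' D' hQ']
    subst hQQ
    have hkQ : insert (k + 1) D ∉ Q := fun h => by
      have := Finset.mem_Icc.1 (hQ.subset _ h (Finset.mem_insert_self _ _))
      omega
    have hmem : insert (k + 1) D ∈ insert (insert (k + 1) D') Q :=
      heq ▸ Finset.mem_insert_self _ _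
    have hins := (Finset.mem_insert.1 hmem).resolve_right hkQ
    have hnot : ∀ E ⊆ Finset.Icc 1 k \ Q.biUnion id, k + 1 ∉ E := fun E hE h => by
      have := Finset.mem_Icc.1 (Finset.mem_sdiff.1 (hE h)).1
      omega
    rw [← Finset.erase_insert (hnot D hD), hins, Finset.erase_insert (hnot D' hD')]
  · intro R hR
    have hR := mem_pathFamilies.1 hR
    obtain ⟨D, hD, hcard, heq⟩ := hR.exists_eq_insert hk
    refine ⟨⟨R.filter (fun C => k + 1 ∉ C), D⟩, ?_, heq⟩
    exact Finset.mem_sigma.2 ⟨mem_pathFamilies.2 hR.filter_notMem,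
      Finset.mem_powersetCard.2 ⟨hD, by dsimp only; omega⟩⟩

theorem card_pathFamilies {S : ℕ → ℕ} {k : ℕ} (h0 : S 0 = 0)
    (hS : ∀ j < k, S j ≤ S (j + 1)) (hle : ∀ j ≤ k, S j ≤ j) :
    (pathFamilies S k).card =
      ∏ j ∈ (Finset.Icc 1 k).filter (fun j => S (j - 1) < S j),
        (j - 1 - S (j - 1)).choose (j - S j) := by
  induction k with
  | zero => simp [pathFamilies_zero]
  | succ k ih =>
    have ih := ih (fun j hj => hS j (by omega)) (fun j hj => hle j (by omega))
    rw [Finset.prod_filter, Finset.prod_Icc_succ_top (by omega), ← Finset.prod_filter, ← ih,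
      Nat.add_sub_cancel]
    split_ifs with hk
    · exact card_pathFamilies_succ h0 (fun j hj => hS j (by omega)) hk (hle _ le_rfl)
    · have heq : S (k + 1) = S k := le_antisymm (not_lt.1 hk) (hS k (Nat.lt_succ_self k))
      rw [mul_one]
      congr 1
      ext Q
      rw [mem_pathFamilies, mem_pathFamilies, IsPathFamily.succ_iff_of_eq heq]

namespace Finpartition

variable {n : ℕ}

/-- The path of a partition: at `j`, the number of elements in cells with maximum at most `j`. -/
def path (p : Finpartition (Finset.Icc 1 n)) (j : ℕ) : ℕ :=
  ∑ C ∈ p.parts with C.sup id ≤ j, C.card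

theorem path_mono (p : Finpartition (Finset.Icc 1 n)) : Monotone p.path := by
  intro i j hij
  refine Finset.sum_le_sum_of_subset fun C hC => ?_
  obtain ⟨hC, hi⟩ := Finset.mem_filter.1 hC
  exact Finset.mem_filter.2 ⟨hC, hi.trans hij⟩

theorem path_le (p : Finpartition (Finset.Icc 1 n)) (j : ℕ) : p.path j ≤ j := by
  have hdis : ((p.parts.filter (fun C => C.sup id ≤ j) : Finset (Finset ℕ)) :
      Set (Finset ℕ)).PairwiseDisjoint id :=
    p.disjoint.subset (Finset.coe_subset.2 (Finset.filter_subset _ _))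
  have hcard := Finset.card_biUnion hdis
  have hsub : (p.parts.filter (fun C => C.sup id ≤ j)).biUnion id ⊆ Finset.Icc 1 j := by
    refine Finset.biUnion_subset.2 fun C hC x hx => ?_
    obtain ⟨hC, hj⟩ := Finset.mem_filter.1 hC
    exact Finset.mem_Icc.2
      ⟨(Finset.mem_Icc.1 (p.subset hC hx)).1, (Finset.le_sup_id_of_mem hx).trans hj⟩
  have hle := Finset.card_le_card hsub
  rw [hcard, Nat.card_Icc, Nat.add_sub_cancel] at hle
  exact hle

theorem path_eq (p : Finpartition (Finset.Icc 1 n)) {j : ℕ} (hj : n ≤ j) : p.path j = n := by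
  rw [path, Finset.filter_true_of_mem, p.sum_card_parts, Nat.card_Icc, Nat.add_sub_cancel]
  intro C hC
  exact Finset.sup_le fun x hx => (Finset.mem_Icc.1 (p.subset hC hx)).2.trans hj

theorem isSPath_path (p : Finpartition (Finset.Icc 1 n)) : IsSPath n p.path :=
  ⟨Nat.le_zero.1 (p.path_le 0), p.path_eq le_rfl, fun j _ => p.path_le j,
    fun j _ => p.path_mono (Nat.le_succ j)⟩

theorem path_pred_add_sum (p : Finpartition (Finset.Icc 1 n)) {j : ℕ} (hj : 1 ≤ j) :
    p.path (j - 1) + ∑ C ∈ p.parts with C.sup id = j, C.card = p.path j := by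
  rw [path, path, ← Finset.sum_union]
  · congr 1
    ext C
    simp only [Finset.mem_union, Finset.mem_filter, ← and_or_left]
    exact and_congr_right fun _ => by omega
  · refine Finset.disjoint_filter.2 fun C _ h => by omega

theorem isPathFamily_parts (p : Finpartition (Finset.Icc 1 n)) :
    IsPathFamily p.path n p.parts := by
  have hdis : ∀ C ∈ p.parts, ∀ D ∈ p.parts, ∀ x ∈ C, x ∈ D → C = D :=
    fun C hC D hD x hx hx' => p.eq_of_mem_parts hC hD hx hx'
  refine ⟨fun C hC => p.subset hC, fun C hC => p.nonempty_of_mem_parts hC, hdis,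
    fun j hj hlt => ?_, fun C hC => ?_⟩
  · have hsum := p.path_pred_add_sum (Finset.mem_Icc.1 hj).1
    obtain ⟨C, hC, -⟩ := Finset.exists_ne_zero_of_sum_ne_zero
      (s := p.parts.filter (fun C => C.sup id = j)) (f := Finset.card) (by omega)
    exact ⟨C, Finset.mem_filter.1 hC⟩
  · have hmem := (p.nonempty_of_mem_parts hC).sup_id_mem
    have hsum := p.path_pred_add_sum (Finset.mem_Icc.1 (p.subset hC hmem)).1
    have hfilter : p.parts.filter (fun D => D.sup id = C.sup id) = {C} := by
      ext D
      rw [Finset.mem_filter, Finset.mem_singleton]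
      constructor
      · rintro ⟨hD, hDC⟩
        refine hdis D hD C hC (C.sup id) ?_ hmem
        rw [← hDC]
        exact (p.nonempty_of_mem_parts hD).sup_id_mem
      · rintro rfl
        exact ⟨hC, rfl⟩
    rw [hfilter, Finset.sum_singleton] at hsum
    omega

theorem path_eq_iff (p : Finpartition (Finset.Icc 1 n)) {S : ℕ → ℕ} (hS : IsSPath n S)
    (hn : ∀ j, n ≤ j → S j = n) : p.path = S ↔ IsPathFamily S n p.parts := by
  constructor
  · rintro rfl
    exact p.isPathFamily_parts
  · intro h
    funext j
    rcases le_total j n with hj | hj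
    · exact h.sum_card_filter hS.1 hS.2.2.2 hj
    · rw [p.path_eq hj, hn j hj]

end Finpartition

open Classical in
theorem card_filter_path_eq {n : ℕ} {S : ℕ → ℕ} (hS : IsSPath n S)
    (hn : ∀ j, n ≤ j → S j = n) :
    (Finset.univ.filter (fun p : Finpartition (Finset.Icc 1 n) => p.path = S)).card =
      (pathFamilies S n).card := by
  refine Finset.card_bij (fun p _ => p.parts) ?_ ?_ ?_
  · intro p hp
    exact mem_pathFamilies.2 ((p.path_eq_iff hS hn).1 (Finset.mem_filter.1 hp).2)
  · intro p _ q _ hpq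
    exact Finpartition.ext hpq
  · intro Q hQ
    have hQ := mem_pathFamilies.1 hQ
    have hunion : Q.biUnion id = Finset.Icc 1 n := by
      refine Finset.eq_of_subset_of_card_le hQ.biUnion_subset ?_
      rw [hQ.card_biUnion hS.1 hS.2.2.2, hS.2.1, Nat.card_Icc, Nat.add_sub_cancel]
    let p : Finpartition (Finset.Icc 1 n) :=
      { parts := Q
        supIndep := Finset.supIndep_iff_pairwiseDisjoint.2 hQ.pairwiseDisjoint
        sup_parts := by rw [Finset.sup_eq_biUnion, hunion]
        bot_notMem := fun h => (hQ.nonempty _ h).ne_empty rfl }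
    exact ⟨p, Finset.mem_filter.2 ⟨Finset.mem_univ _, (p.path_eq_iff hS hn).2 hQ⟩, rfl⟩

theorem finite_setOf_isSPath (n : ℕ) :
    {S : ℕ → ℕ | IsSPath n S ∧ ∀ j, n ≤ j → S j = n}.Finite := by
  refine Set.Finite.of_finite_image (f := fun S (i : Fin n) => S i) ?_ ?_
  · refine (Set.Finite.pi' fun _ : Fin n => Set.finite_Iic n).subset ?_
    rintro _ ⟨S, ⟨hS, -⟩, rfl⟩ i
    exact (hS.2.2.1 i i.2).trans i.2.le
  · rintro S ⟨-, hS⟩ T ⟨-, hT⟩ hST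
    funext j
    rcases lt_or_ge j n with hj | hj
    · exact congrFun hST ⟨j, hj⟩
    · rw [hS j hj, hT j hj]

/-- Rao–Blackwellization identity: for any `ψ : ℕ × ℕ → ℝ`, the sum over all
partitions `p` of `{1,…,n}` of `∏_{C ∈ p} ψ(|C|, max C)` equals the sum over all
S-paths `S` of `n+1` coordinates (encoded as functions `ℕ → ℕ` pinned to `n` beyond
coordinate `n`) of
`[∏_{j : m_j > 0} binom(j-1-S_{j-1}, j-S_j)] · [∏_{j : m_j > 0} ψ(m_j, j)]`. -/
theorem partition_sum_eq_path_sum (n : ℕ) (hn : 1 ≤ n) (ψ : ℕ × ℕ → ℝ) :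
    (∑ᶠ p : Finpartition (Finset.Icc 1 n), ∏ C ∈ p.parts, ψ (C.card, C.sup id)) =
      ∑ᶠ S ∈ {S : ℕ → ℕ | IsSPath n S ∧ ∀ j, n ≤ j → S j = n},
        (∏ j ∈ (Finset.Icc 1 n).filter (fun j => S (j - 1) < S j),
            (Nat.choose (j - 1 - S (j - 1)) (j - S j) : ℝ)) *
          ∏ j ∈ (Finset.Icc 1 n).filter (fun j => S (j - 1) < S j),
            ψ (S j - S (j - 1), j) := by
  classical
  rw [finsum_eq_sum_of_fintype, finsum_mem_eq_finite_toFinset_sum _ (finite_setOf_isSPath n),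
    ← Finset.sum_fiberwise_of_maps_to (t := (finite_setOf_isSPath n).toFinset)
      (g := Finpartition.path)
      fun p _ => (finite_setOf_isSPath n).mem_toFinset.2 ⟨p.isSPath_path, fun _ => p.path_eq⟩]
  refine Finset.sum_congr rfl fun S hS => ?_
  obtain ⟨hS, hSn⟩ := (finite_setOf_isSPath n).mem_toFinset.1 hS
  have hle : ∀ j ≤ n, S j ≤ j := fun j hj => by
    rcases hj.lt_or_eq with hj | rfl
    · exact hS.2.2.1 j hj
    · exact hS.2.1.le
  rw [← Nat.cast_prod, ← card_pathFamilies hS.1 hS.2.2.2 hle, ← card_filter_path_eq hS hSn,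
    ← nsmul_eq_mul, ← Finset.sum_const]
  refine Finset.sum_congr rfl fun p hp => ?_
  exact ((p.path_eq_iff hS hSn).1 (Finset.mem_filter.1 hp).2).prod_eq fun m j => ψ (m, j)
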